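/- Let m, n be positive integers with ⌊m/n⌋ ≥ 2, and let k, ℓ, k′, ℓ′ be positive integers with k + ℓ = k′ + ℓ′. Then the sets D_{m,n}^{(k,ℓ)} and D_{m,n}^{(k′,ℓ′)} have the same cardinality (i.e., the matrix with (k,ℓ)-entry |D_{m,n}^{(k,ℓ)}| is a Hankel matrix). -/

import Mathlib

open scoped Classical

namespace RationalDyck

/-- A lattice path: `true` = a north step `N`, `false` = an east step `E`. -/
abbrev Path : Type := List Bool

/-- The rank of the endpoint of a path prefix `Q` in the `m × n` grid:
`rank(i,j) = j*m - i*n`, where `i` is the number of east steps of `Q`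
and `j` the number of north steps of `Q`. -/
def prefRank (m n : ℕ) (Q : Path) : ℤ :=
  (Q.count true : ℤ) * m - (Q.count false : ℤ) * n

/-- `P` is an `m × n` rational Dyck path: it goes from `(0,0)` to `(m,n)` and
stays weakly above the line `y = n x / m`. -/
def IsDyck (m n : ℕ) (P : Path) : Prop :=
  P.count false = m ∧ P.count true = n ∧ ∀ i ≤ P.length, 0 ≤ prefRank m n (P.take i)

/-- The return statistic: the number of lattice points on `P` other than `(m,n)`
whose rank is strictly less than `n`. -/
def retStat (m n : ℕ) (P : Path) : ℕ :=
  ((List.range P.length).filter fun i => prefRank m n (P.take i) < (n : ℤ)).length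

/-- The coarea sequence of `P`: for each north step (from bottom to top), the number
of cells of the rectangle strictly to its left, i.e. the number of east steps before it. -/
def coarea (P : Path) : List ℕ :=
  (List.range P.length).filterMap fun i =>
    if P.getD i false = true then some ((P.take i).count false) else none

/-- The run statistic: the least `i ∈ [n]` not appearing in the coarea sequence. -/
noncomputable def runStat (P : Path) : ℕ :=
  sInf {i : ℕ | 1 ≤ i ∧ i ≤ P.count true ∧ i ∉ coarea P}

/-- The ratio-run statistic: with `k = ⌊m/n⌋`, the least `i ∈ [n]` such that `k*i`
does not appear in the coarea sequence. -/
noncomputable def ratioRun (m n : ℕ) (P : Path) : ℕ :=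
  sInf {i : ℕ | 1 ≤ i ∧ i ≤ P.count true ∧ (m / n) * i ∉ coarea P}

/-- The composition type of `P`: the lengths of the maximal blocks of consecutive
north steps, read from start to end. -/
def compType (P : Path) : List ℕ :=
  ((P.splitOn false).map List.length).filter fun x => x ≠ 0

/-- The number of maximal blocks of consecutive north steps (vertical components). -/
def nc (P : Path) : ℕ := (compType P).length

/-- `α` is a (strong) composition of `n`. -/
def IsComposition (n : ℕ) (α : List ℕ) : Prop :=
  (∀ a ∈ α, 0 < a) ∧ α.sum = n

/-- The finite set of all `m × n` rational Dyck paths. -/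
noncomputable def dyckPaths (m n : ℕ) : Finset Path :=
  ((Finset.univ : Finset (Fin (m + n) → Bool)).image List.ofFn).filter fun P => IsDyck m n P

/-- The `m × n` rational Dyck paths of composition type `α`. -/
noncomputable def dyckPathsComp (m n : ℕ) (α : List ℕ) : Finset Path :=
  (dyckPaths m n).filter fun P => compType P = α

/-- The `m × n` rational Dyck paths with `run = k` and `ret = l`. -/
noncomputable def dyckPathsRR (m n k l : ℕ) : Finset Path :=
  (dyckPaths m n).filter fun P => runStat P = k ∧ retStat m n P = l

/-- The `m × n` rational Dyck paths of composition type `α` with `run = k` and `ret = l`. -/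
noncomputable def dyckPathsCompRR (m n : ℕ) (α : List ℕ) (k l : ℕ) : Finset Path :=
  (dyckPathsComp m n α).filter fun P => runStat P = k ∧ retStat m n P = l

/-- The number of initial parts of `α` equal to `1`. -/
def iones (α : List ℕ) : ℕ := (α.takeWhile fun a => a = 1).length

/-- `rr(α, m) = min(Iones(α) + 1, ⌈n/(m-n)⌉)` where `n = |α|` is the sum of parts. -/
def rr (m : ℕ) (α : List ℕ) : ℕ :=
  min (iones α + 1) ((α.sum + (m - α.sum) - 1) / (m - α.sum))


/-- The change of rank along a single step. -/
def stepRank (m n : ℕ) (b : Bool) : ℤ := if b then m else -n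

/-- All ranks along `P`, started at rank `r`, are nonnegative. -/
def StaysNonneg (m n : ℕ) : ℤ → Path → Prop
  | r, [] => 0 ≤ r
  | r, b :: P => 0 ≤ r ∧ StaysNonneg m n (r + stepRank m n b) P

/-- The number of points of `P` other than the last one with rank less than `n`, when `P` is
started at rank `r`. -/
def retFrom (m n : ℕ) : ℤ → Path → ℕ
  | _, [] => 0
  | r, b :: P => (if r < n then 1 else 0) + retFrom m n (r + stepRank m n b) P

/-- The number of east steps of `P` before the first east step directly preceded by an east step;
the flag records whether `P` itself is preceded by an east step. -/
def runFrom : Bool → Path → ℕ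
  | true, [] => 0
  | false, [] => 1
  | _, true :: P => runFrom false P
  | true, false :: _ => 0
  | false, false :: P => runFrom true P + 1

/-- Delete the step that leaves the first point of rank less than `n`. -/
def removeReturn (m n : ℕ) : ℤ → Path → Path
  | _, [] => []
  | r, b :: P => if r < n then P else b :: removeReturn m n (r + stepRank m n b) P

/-- Insert a north step at the first point of rank less than `n`. -/
def insertReturn (m n : ℕ) : ℤ → Path → Path
  | _, [] => [true]
  | r, b :: P =>
    if r < n then true :: b :: P else b :: insertReturn m n (r + stepRank m n b) P

/-- Insert an east step after the initial block of north steps. -/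
def insertEast : Path → Path
  | true :: P => true :: insertEast P
  | P => false :: P

/-- Fill the first empty column of a path: the first factor `E E Nᵃ` becomes `E Nᵃ⁺¹ E`. -/
def fillColumn : Bool → Path → Path
  | _, [] => []
  | true, false :: P => true :: insertEast P
  | _, b :: P => b :: fillColumn (!b) P

/-- Empty the last nonempty column before the first empty one. -/
noncomputable def emptyColumn : Bool → Path → Path
  | _, [] => []
  | true, true :: P =>
    if runFrom false P = 1 then false :: P.erase false else true :: emptyColumn false P
  | _, b :: P => b :: emptyColumn (!b) P

section Rank

variable {m n : ℕ}

@[simp] lemma stepRank_true : stepRank m n true = m := by simp [stepRank]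

@[simp] lemma stepRank_false : stepRank m n false = -n := by simp [stepRank]

@[simp] lemma prefRank_nil : prefRank m n [] = 0 := by simp [prefRank]

@[simp] lemma prefRank_cons (b : Bool) (P : Path) :
    prefRank m n (b :: P) = stepRank m n b + prefRank m n P := by
  cases b <;> simp [prefRank] <;> ring

lemma StaysNonneg.nonneg {r : ℤ} {P : Path} (h : StaysNonneg m n r P) : 0 ≤ r := by
  cases P with
  | nil => exact h
  | cons b P => exact h.1

lemma staysNonneg_iff (r : ℤ) (P : Path) :
    StaysNonneg m n r P ↔ ∀ i ≤ P.length, 0 ≤ r + prefRank m n (P.take i) := by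
  induction P generalizing r with
  | nil => simp [StaysNonneg]
  | cons b P ih =>
    rw [StaysNonneg, ih]
    constructor
    · rintro ⟨h0, h⟩ (_ | i) hi
      · simpa using h0
      · simpa [add_assoc] using h i (by simpa using hi)
    · intro h
      refine ⟨by simpa using h 0 (by simp), fun i hi => ?_⟩
      simpa [add_assoc] using h (i + 1) (by simpa using hi)

lemma length_filter_range_prefRank (r : ℤ) (P : Path) :
    ((List.range P.length).filter fun i => r + prefRank m n (P.take i) < (n : ℤ)).length =
      retFrom m n r P := by
  induction P generalizing r with
  | nil => simp [retFrom]
  | cons b P ih =>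
    rw [retFrom, ← ih, List.length_cons, List.range_succ_eq_map, List.filter_cons,
      List.filter_map, apply_ite List.length]
    simp only [List.length_cons, List.length_map, Function.comp_def, List.take_zero,
      List.take_succ_cons, prefRank_nil, prefRank_cons, add_zero, add_assoc, Nat.succ_eq_add_one]
    split_ifs <;> simp_all [add_comm]

lemma retStat_eq (P : Path) : retStat m n P = retFrom m n 0 P := by
  simp [retStat, ← length_filter_range_prefRank]

lemma false_mem_of_prefRank_neg {P : Path} (h : prefRank m n P < 0) : false ∈ P := by
  by_contra hP
  rw [prefRank, List.count_eq_zero.2 hP] at h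
  have : (0 : ℤ) ≤ (P.count true : ℤ) * m := by positivity
  simp at h
  omega

end Rank

section Run

@[simp] lemma coarea_nil : coarea [] = [] := rfl

lemma coarea_cons (b : Bool) (P : Path) :
    coarea (b :: P) = (if b then [0] else []) ++
      (coarea P).map fun i => (if b then 0 else 1) + i := by
  rw [coarea, List.length_cons, List.range_succ_eq_map, List.filterMap_cons, List.filterMap_map,
    coarea, List.map_filterMap]
  have key : (fun i => if (b :: P).getD i false = true
      then some (((b :: P).take i).count false) else none) ∘ Nat.succ =
      fun i => Option.map (fun i => (if b then 0 else 1) + i)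
        (if P.getD i false = true then some ((P.take i).count false) else none) := by
    funext i
    cases b <;> simp [apply_ite (Option.map _), add_comm]
  rw [key]
  cases b <;> simp

lemma mem_coarea_true {P : Path} {j : ℕ} : j ∈ coarea (true :: P) ↔ j = 0 ∨ j ∈ coarea P := by
  simp [coarea_cons]

lemma mem_coarea_false {P : Path} {j : ℕ} :
    j ∈ coarea (false :: P) ↔ ∃ i ∈ coarea P, i + 1 = j := by
  simp [coarea_cons, add_comm]

lemma runFrom_false_pos (P : Path) : 0 < runFrom false P := by
  induction P with
  | nil => simp [runFrom]
  | cons b P ih => cases b <;> simp [runFrom, ih]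

lemma runFrom_le (p : Bool) (P : Path) :
    runFrom p P ≤ P.count true + if p then 0 else 1 := by
  induction P generalizing p with
  | nil => cases p <;> simp [runFrom]
  | cons b P ih =>
    have h1 := ih false
    have h2 := ih true
    cases p <;> cases b <;> simp_all [runFrom]; omega

lemma isLeast_runFrom (p : Bool) (P : Path) :
    IsLeast {j : ℕ | (p = false → 1 ≤ j) ∧ j ∉ coarea P} (runFrom p P) := by
  induction P generalizing p with
  | nil =>
    cases p
    · exact ⟨by simp [runFrom], fun j hj => by simpa [runFrom] using hj⟩
    · exact ⟨by simp [runFrom], fun j hj => by simp [runFrom]⟩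
  | cons b P ih =>
    obtain ⟨⟨hf0, hf1⟩, hf2⟩ := ih false
    obtain ⟨⟨ht0, ht1⟩, ht2⟩ := ih true
    have hpos := runFrom_false_pos P
    cases b
    · cases p
      · refine ⟨⟨fun _ => by simp [runFrom], ?_⟩, ?_⟩
        · simpa [runFrom, mem_coarea_false] using ht1
        · rintro (_ | j) ⟨hj, hj'⟩
          · simp at hj
          · have := ht2 (a := j) ⟨by simp, fun h => hj' (mem_coarea_false.2 ⟨j, h, rfl⟩)⟩
            simpa [runFrom] using this
      · refine ⟨⟨by simp, ?_⟩, fun j hj => by simp [runFrom]⟩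
        simp [runFrom, mem_coarea_false]
    · have hrun : runFrom p (true :: P) = runFrom false P := by cases p <;> rfl
      rw [hrun]
      refine ⟨⟨fun _ => hpos, ?_⟩, ?_⟩
      · rw [mem_coarea_true]
        rintro (h | h)
        · omega
        · exact hf1 h
      · rintro j ⟨-, hj⟩
        rw [mem_coarea_true] at hj
        exact hf2 ⟨fun _ => by omega, fun h => hj (Or.inr h)⟩

lemma runStat_cons_true (P : Path) : runStat (true :: P) = runFrom false P := by
  obtain ⟨⟨h0, h1⟩, h2⟩ := isLeast_runFrom false (true :: P)
  refine IsLeast.csInf_eq (a := runFrom false (true :: P)) ⟨⟨h0 rfl, ?_, h1⟩, ?_⟩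
  · simpa [runFrom] using runFrom_le false P
  · rintro j ⟨hj, -, hj'⟩
    exact h2 ⟨fun _ => hj, hj'⟩

end Run

section Return

variable {m n : ℕ}

lemma removeReturn_spec {r : ℤ} {P : Path} (hP : StaysNonneg m n r P) (hret : 0 < retFrom m n r P) :
    (removeReturn m n r P).count true + 1 = P.count true ∧
    (removeReturn m n r P).count false = P.count false ∧
    StaysNonneg m n (r + m) (removeReturn m n r P) ∧
    retFrom m n (r + m) (removeReturn m n r P) + 1 = retFrom m n r P ∧
    insertReturn m n r (removeReturn m n r P) = P := by
  induction P generalizing r with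
  | nil => simp [retFrom] at hret
  | cons b P ih =>
    obtain ⟨h0, hP⟩ := hP
    by_cases hr : r < n
    · cases b
      · have := hP.nonneg
        simp at this
        omega
      · simp only [stepRank_true] at hP
        simp only [removeReturn, if_pos hr, retFrom, stepRank_true]
        refine ⟨by simp, by simp, hP, by omega, ?_⟩
        cases P <;> simp [insertReturn, hr]
    · have hrm : ¬ r + m < n := by omega
      simp only [retFrom, if_neg hr, zero_add] at hret
      obtain ⟨h1, h2, h3, h4, h5⟩ := ih hP hret
      rw [add_right_comm] at h3 h4
      simp only [removeReturn, if_neg hr, retFrom, if_neg hrm, insertReturn, zero_add, h5,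
        StaysNonneg, List.count_cons, h2, h3, h4]
      exact ⟨by omega, trivial, ⟨by omega, trivial⟩, trivial, trivial⟩

lemma insertReturn_spec (hm : 0 < m) {r : ℤ} {P : Path} (hr0 : 0 ≤ r)
    (hP : StaysNonneg m n (r + m) P) (hend : r + m + prefRank m n P = 0) :
    (insertReturn m n r P).count true = P.count true + 1 ∧
    (insertReturn m n r P).count false = P.count false ∧
    StaysNonneg m n r (insertReturn m n r P) ∧
    retFrom m n r (insertReturn m n r P) = retFrom m n (r + m) P + 1 ∧
    removeReturn m n r (insertReturn m n r P) = P := by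
  induction P generalizing r with
  | nil => simp at hend; omega
  | cons b P ih =>
    by_cases hr : r < n
    · simp only [insertReturn, if_pos hr, retFrom, StaysNonneg, removeReturn, stepRank_true]
      exact ⟨by simp, by simp, ⟨hr0, hP⟩, by omega, trivial⟩
    · have hrm : ¬ r + m < n := by omega
      have hstep : 0 ≤ r + stepRank m n b := by cases b <;> simp <;> omega
      obtain ⟨-, hP⟩ := hP
      rw [add_right_comm] at hP
      obtain ⟨h1, h2, h3, h4, h5⟩ := ih hstep hP (by rw [prefRank_cons] at hend; linarith)
      simp only [insertReturn, if_neg hr, retFrom, if_neg hrm, removeReturn, zero_add, h5,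
        StaysNonneg, List.count_cons, add_right_comm r, h1, h2, h3, h4]
      exact ⟨by omega, trivial, ⟨hr0, trivial⟩, trivial, trivial⟩

lemma runFrom_removeReturn (hmn : 2 * n ≤ m) {p : Bool} {r : ℤ} (P : Path)
    (hr : (m : ℤ) - (if p then n else 0) ≤ r) :
    runFrom p (removeReturn m n r P) = runFrom p P := by
  induction P generalizing p r with
  | nil => rfl
  | cons b P ih =>
    have hrn : ¬ r < n := by cases p <;> simp at hr <;> omega
    rw [removeReturn, if_neg hrn]
    cases b
    · cases p
      · simp only [runFrom]
        rw [ih]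
        simp at hr ⊢
        omega
      · simp [runFrom]
    · have : runFrom false (removeReturn m n (r + stepRank m n true) P) = runFrom false P := by
        apply ih
        cases p <;> simp at hr ⊢ <;> omega
      cases p <;> simpa [runFrom] using this

end Return

section Column

variable {m n : ℕ}

lemma erase_insertEast (P : Path) : (insertEast P).erase false = P := by
  induction P with
  | nil => simp [insertEast]
  | cons b P ih => cases b <;> simp [insertEast, ih]

lemma runFrom_insertEast (P : Path) : runFrom false (insertEast P) = 1 := by
  induction P with
  | nil => simp [insertEast, runFrom]
  | cons b P ih => cases b <;> simp [insertEast, runFrom, ih]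

lemma count_insertEast (P : Path) :
    (insertEast P).count true = P.count true ∧
      (insertEast P).count false = P.count false + 1 := by
  induction P with
  | nil => simp [insertEast]
  | cons b P ih => cases b <;> simp [insertEast, ih]

lemma insertEast_erase {P : Path} (hP : false ∈ P) (hrun : runFrom false P = 1) :
    insertEast (P.erase false) = P := by
  induction P with
  | nil => simp at hP
  | cons b P ih =>
    cases b
    · rcases P with - | ⟨_ | _, P⟩
      · simp [insertEast]
      · simp [insertEast]
      · have := runFrom_false_pos P
        simp [runFrom] at hrun
        omega
    · simp only [runFrom] at hrun
      simpa [insertEast] using ih (by simpa using hP) hrun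

lemma staysNonneg_insertEast {r : ℤ} {P : Path} (hP : StaysNonneg m n r P) :
    StaysNonneg m n (r + n) (insertEast P) := by
  induction P generalizing r with
  | nil =>
    have := hP.nonneg
    simp only [insertEast, StaysNonneg, stepRank_false]
    omega
  | cons b P ih =>
    have := hP.nonneg
    cases b
    · refine ⟨by omega, ?_⟩
      simpa using hP
    · refine ⟨by omega, ?_⟩
      rw [add_right_comm]
      exact ih hP.2

lemma retFrom_insertEast {r : ℤ} {P : Path} (hr : (n : ℤ) ≤ r) :
    retFrom m n (r + n) (insertEast P) = retFrom m n r P := by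
  have hr' : ¬ r + n < n := by omega
  induction P generalizing r with
  | nil => simp [insertEast, retFrom]; omega
  | cons b P ih =>
    cases b
    · simp [insertEast, retFrom]; omega
    · have hr'' : ¬ r < n := by omega
      rw [insertEast, retFrom, retFrom, if_neg hr', if_neg hr'', add_right_comm, ih] <;>
        simp <;> omega

lemma staysNonneg_erase {r : ℤ} {P : Path} (hr : (n : ℤ) ≤ r) (hP : StaysNonneg m n r P) :
    StaysNonneg m n (r - n) (P.erase false) := by
  induction P generalizing r with
  | nil => simp [StaysNonneg]; omega
  | cons b P ih =>
    cases b
    · simpa [sub_eq_add_neg] using hP.2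
    · have := ih (r := r + m) (by omega) (by simpa using hP.2)
      simp only [List.erase_cons, StaysNonneg, stepRank_true, beq_iff_eq, Bool.true_eq_false,
        if_false]
      exact ⟨by omega, by rwa [sub_add_eq_add_sub]⟩

lemma runFrom_cons_true (p : Bool) (P : Path) : runFrom p (true :: P) = runFrom false P := by
  cases p <;> rfl

lemma fillColumn_cons_true (p : Bool) (P : Path) :
    fillColumn p (true :: P) = true :: fillColumn false P := by
  cases p <;> rfl

lemma fillColumn_spec (hn : 0 < n) (hmn : 2 * n ≤ m) {p : Bool} {r : ℤ} {P : Path}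
    (hr : (m : ℤ) - (if p then n else 0) ≤ r)
    (hP : StaysNonneg m n (r + m) P) (hend : r + m + prefRank m n P = 0) :
    (fillColumn p P).count true = P.count true + 1 ∧
    (fillColumn p P).count false = P.count false ∧
    StaysNonneg m n r (fillColumn p P) ∧
    retFrom m n r (fillColumn p P) = retFrom m n (r + m) P ∧
    runFrom p (fillColumn p P) = runFrom p P + 1 ∧
    emptyColumn p (fillColumn p P) = P := by
  have hrn : ¬ r < n := by cases p <;> simp at hr <;> omega
  have hrm : ¬ r + m < n := by omega
  have hr0 : 0 ≤ r := by omega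
  induction P generalizing p r with
  | nil => simp at hend; omega
  | cons b P ih =>
    obtain ⟨-, hP⟩ := hP
    rw [prefRank_cons] at hend
    cases b
    · cases p
      · simp only [stepRank_false, Bool.false_eq_true, if_false] at hP hr hend
        rw [add_right_comm] at hP
        obtain ⟨h1, h2, h3, h4, h5, h6⟩ := ih (p := true) (r := r + -n) (by simp; omega) hP
          (by linarith) (by omega) (by omega) (by omega)
        simp [fillColumn, StaysNonneg, retFrom, runFrom, emptyColumn, hrn, hrm, hr0, h1, h2, h3,
          h4, h5, h6, add_right_comm]
      · simp only [stepRank_false, if_true] at hP hr hend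
        obtain ⟨c1, c2⟩ := count_insertEast P
        have hv := staysNonneg_insertEast hP
        have hret := retFrom_insertEast (m := m) (n := n) (r := r + m + -n) (P := P) (by omega)
        rw [neg_add_cancel_right] at hv hret
        simp [fillColumn, StaysNonneg, retFrom, runFrom, emptyColumn, hrn, hrm, hr0, c1, c2, hv,
          hret, runFrom_insertEast, erase_insertEast]
    · simp only [stepRank_true] at hP hend
      obtain ⟨h1, h2, h3, h4, h5, h6⟩ := ih (p := false) (r := r + m) (by simp; omega) hP
        (by linarith) (by omega) (by omega) (by omega)
      have hpos := runFrom_false_pos P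
      rw [fillColumn_cons_true, runFrom_cons_true, runFrom_cons_true]
      refine ⟨by simp [h1], by simp [h2], ⟨hr0, by simpa using h3⟩, ?_, h5, ?_⟩
      · simp [retFrom, hrn, hrm, h4]
      · cases p
        · simp [emptyColumn, h6]
        · simp [emptyColumn, h6, h5, hpos.ne']

lemma emptyColumn_spec (hn : 0 < n) (hmn : 2 * n ≤ m) {p : Bool} {r : ℤ} {P : Path}
    (hr : (m : ℤ) - (if p then n else 0) ≤ r)
    (hP : StaysNonneg m n r P) (hend : r + prefRank m n P = 0)
    (hrun : (if p then 0 else 1) < runFrom p P) :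
    (emptyColumn p P).count true + 1 = P.count true ∧
    (emptyColumn p P).count false = P.count false ∧
    StaysNonneg m n (r + m) (emptyColumn p P) ∧ fillColumn p (emptyColumn p P) = P := by
  have hr0 : 0 ≤ r + m := by have := hP.nonneg; omega
  induction P generalizing p r with
  | nil => cases p <;> simp [runFrom] at hrun
  | cons b P ih =>
    obtain ⟨h0, hP⟩ := hP
    rw [prefRank_cons] at hend
    cases b
    · cases p
      · simp only [stepRank_false, Bool.false_eq_true, if_false] at hP hr hend
        obtain ⟨c1, c2, h1, h2⟩ := ih (p := true) (by simp; omega) hP (by linarith)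
          (by simpa [runFrom] using hrun) (by omega)
        simp [emptyColumn, fillColumn, StaysNonneg, hr0, c1, c2, h2]
        rwa [add_right_comm]
      · simp [runFrom] at hrun
    · simp only [stepRank_true] at hP hend
      have hrec (hr1 : 1 < runFrom false P) := ih (p := false) (r := r + m) (by simp; omega) hP
        (by linarith) (by simpa using hr1) (by omega)
      cases p
      · obtain ⟨c1, c2, h1, h2⟩ := hrec (by simpa [runFrom] using hrun)
        simp [emptyColumn, fillColumn, StaysNonneg, hr0, c1, c2, h1, h2]
      · by_cases h1 : runFrom false P = 1
        · have hmem : false ∈ P := by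
            apply false_mem_of_prefRank_neg (m := m) (n := n)
            omega
          simp only [if_true] at hr
          have hcount : P.count false - 1 + 1 = P.count false :=
            Nat.sub_add_cancel (List.count_pos_iff.2 hmem)
          simp [emptyColumn, fillColumn, StaysNonneg, hr0, h1, insertEast_erase hmem h1, hcount]
          exact staysNonneg_erase (by omega) hP
        · have := runFrom_false_pos P
          obtain ⟨c1, c2, h2, h3⟩ := hrec (by omega)
          simp [emptyColumn, fillColumn, StaysNonneg, hr0, c1, c2, h1, h2, h3]

end Column

/-- The paths with `a` north steps and `b` east steps of nonnegative ranks starting at rank `r`,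
with given run and return statistics. -/
def pathsFrom (m n : ℕ) (r : ℤ) (a b k l : ℕ) : Set Path :=
  {P | P.count true = a ∧ P.count false = b ∧ StaysNonneg m n r P ∧ runFrom false P = k ∧
    retFrom m n r P = l}

lemma ncard_pathsFrom_removeReturn {m n : ℕ} (hm : 0 < m) (hmn : 2 * n ≤ m) {a b : ℕ}
    (hend : (m : ℤ) + m + (a * m - b * n) = 0) (k l : ℕ) :
    (pathsFrom m n m (a + 1) b k (l + 1)).ncard = (pathsFrom m n (m + m) a b k l).ncard := by
  refine Set.BijOn.ncard_eq (f := removeReturn m n m)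
    (Set.InvOn.bijOn (f' := insertReturn m n m) ⟨?_, ?_⟩ ?_ ?_)
  · rintro P ⟨-, -, hP, -, hret⟩
    exact (removeReturn_spec hP (by omega)).2.2.2.2
  · rintro P ⟨ha, hb, hP, -, -⟩
    exact (insertReturn_spec hm (by omega) hP (by rw [prefRank, ha, hb, hend])).2.2.2.2
  · rintro P ⟨ha, hb, hP, hrun, hret⟩
    obtain ⟨h1, h2, h3, h4, -⟩ := removeReturn_spec hP (by omega)
    exact ⟨by omega, by omega, h3, by rw [runFrom_removeReturn hmn P (by simp), hrun], by omega⟩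
  · rintro P ⟨ha, hb, hP, hrun, hret⟩
    obtain ⟨h1, h2, h3, h4, h5⟩ :=
      insertReturn_spec hm (by omega) hP (by rw [prefRank, ha, hb, hend])
    refine ⟨by omega, by omega, h3, ?_, by omega⟩
    rw [← runFrom_removeReturn hmn (r := m) _ (by simp), h5, hrun]

lemma ncard_pathsFrom_fillColumn {m n : ℕ} (hn : 0 < n) (hmn : 2 * n ≤ m) {a b : ℕ}
    (hend : (m : ℤ) + m + (a * m - b * n) = 0) {k : ℕ} (hk : 0 < k) (l : ℕ) :
    (pathsFrom m n (m + m) a b k l).ncard = (pathsFrom m n m (a + 1) b (k + 1) l).ncard := by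
  have hfill {P : Path} (hP : P ∈ pathsFrom m n (m + m) a b k l) :=
    fillColumn_spec hn hmn (p := false) (r := m) (by simp) hP.2.2.1
      (by rw [prefRank, hP.1, hP.2.1, hend])
  have hempty {P : Path} (hP : P ∈ pathsFrom m n m (a + 1) b (k + 1) l) :=
    emptyColumn_spec hn hmn (p := false) (r := m) (by simp) hP.2.2.1
      (by rw [prefRank, hP.1, hP.2.1, ← hend]; push_cast; ring)
      (by have := hP.2.2.2.1; simp; omega)
  refine Set.BijOn.ncard_eq (f := fillColumn false)
    (Set.InvOn.bijOn (f' := emptyColumn false) ⟨?_, ?_⟩ ?_ ?_)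
  · exact fun P hP => (hfill hP).2.2.2.2.2
  · exact fun P hP => (hempty hP).2.2.2
  · intro P hP
    obtain ⟨h1, h2, h3, h4, h5, -⟩ := hfill hP
    obtain ⟨ha, hb, -, hrun, hret⟩ := hP
    exact ⟨by omega, by omega, h3, by omega, by omega⟩
  · intro P hP
    obtain ⟨h1, h2, h3, h4⟩ := hempty hP
    obtain ⟨ha, hb, -, hrun, hret⟩ := hP
    have ha' : (emptyColumn false P).count true = a := by omega
    have hb' : (emptyColumn false P).count false = b := by omega
    obtain ⟨-, -, -, h5, h6, -⟩ := fillColumn_spec hn hmn (p := false) (r := m) (by simp) h3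
      (by rw [prefRank, ha', hb', hend])
    rw [h4] at h5 h6
    exact ⟨ha', hb', h3, by omega, by omega⟩

lemma mem_dyckPathsRR {m n k l : ℕ} {P : Path} :
    P ∈ dyckPathsRR m n k l ↔ IsDyck m n P ∧ runStat P = k ∧ retStat m n P = l := by
  simp only [dyckPathsRR, dyckPaths, Finset.mem_filter, Finset.mem_image, Finset.mem_univ,
    true_and, and_congr_left_iff, and_iff_right_iff_imp]
  rintro - ⟨h1, h2, -⟩
  have hlen : P.length = m + n := by
    rw [← h1, ← h2, List.count_false_add_count_true]
  refine ⟨fun i => P[i], List.ext_getElem (by simp [hlen]) fun i hi hi' => by simp⟩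

lemma coe_dyckPathsRR {m n : ℕ} (k l : ℕ) :
    (dyckPathsRR m (n + 1) k (l + 1) : Set Path) =
      Set.image (List.cons true) (pathsFrom m (n + 1) m n m k l) := by
  ext P
  simp only [Finset.mem_coe, mem_dyckPathsRR, Set.mem_image, pathsFrom,
    Set.mem_ofPred_eq, retStat_eq]
  constructor
  · rintro ⟨⟨h1, h2, h3⟩, h4, h5⟩
    replace h3 : StaysNonneg m (n + 1) 0 P := by simpa [staysNonneg_iff] using h3
    rcases P with - | ⟨_ | _, P⟩
    · simp at h2
    · have := h3.2.nonneg
      simp at this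
      omega
    · refine ⟨P, ⟨by simpa using h2, by simpa using h1, by simpa using h3.2,
        by rw [← runStat_cons_true, h4], ?_⟩, rfl⟩
      have hpos : (0 : ℤ) < (n + 1 : ℕ) := by omega
      simp only [retFrom, if_pos hpos, stepRank_true, zero_add] at h5
      omega
  · rintro ⟨P, ⟨h1, h2, h3, h4, h5⟩, rfl⟩
    have h3' : StaysNonneg m (n + 1) 0 (true :: P) := ⟨le_rfl, by simpa using h3⟩
    refine ⟨⟨by simpa using h2, by simpa using h1, by simpa [staysNonneg_iff] using h3'⟩,
      by rw [runStat_cons_true, h4], ?_⟩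
    have hpos : (0 : ℤ) < (n + 1 : ℕ) := by omega
    simp only [retFrom, if_pos hpos, stepRank_true, zero_add]
    omega

lemma card_dyckPathsRR {m n : ℕ} (k l : ℕ) :
    (dyckPathsRR m (n + 1) k (l + 1)).card = (pathsFrom m (n + 1) m n m k l).ncard := by
  rw [← Set.ncard_coe_finset, coe_dyckPathsRR,
    Set.ncard_image_of_injective _ List.cons_injective]

lemma card_dyckPathsRR_step {m n : ℕ} (hm : 0 < m) (hn : 0 < n) (hmn : 2 * n ≤ m) {k l : ℕ}
    (hk : 0 < k) (hl : 0 < l) :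
    (dyckPathsRR m n k (l + 1)).card = (dyckPathsRR m n (k + 1) l).card := by
  obtain ⟨l, rfl⟩ := Nat.exists_eq_succ_of_ne_zero hl.ne'
  obtain ⟨n, rfl⟩ := Nat.exists_eq_succ_of_ne_zero hn.ne'
  simp only [Nat.succ_eq_add_one, card_dyckPathsRR] at *
  rcases n with - | n
  · have h1 : pathsFrom m (0 + 1) m 0 m k (l + 1) = ∅ := by
      refine Set.eq_empty_of_forall_notMem ?_
      rintro P ⟨ha, -, hP, -, hret⟩
      have := (removeReturn_spec hP (by omega)).1
      omega
    have h2 : pathsFrom m (0 + 1) m 0 m (k + 1) l = ∅ := by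
      refine Set.eq_empty_of_forall_notMem ?_
      rintro P ⟨ha, -, -, hrun, -⟩
      have := runFrom_le false P
      simp at this
      omega
    rw [h1, h2]
  · have hend : (m : ℤ) + m + (n * m - m * (n + 1 + 1 : ℕ)) = 0 := by push_cast; ring
    rw [ncard_pathsFrom_removeReturn hm hmn hend, ncard_pathsFrom_fillColumn hn hmn hend hk]

lemma card_dyckPathsRR_eq {m n : ℕ} (hm : 0 < m) (hn : 0 < n) (hmn : 2 * n ≤ m) (k : ℕ) {l : ℕ}
    (hl : 0 < l) : (dyckPathsRR m n (k + 1) l).card = (dyckPathsRR m n 1 (k + l)).card := by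
  induction k generalizing l with
  | zero => simp
  | succ k ih =>
    rw [← card_dyckPathsRR_step hm hn hmn k.succ_pos hl, ih l.succ_pos]
    congr 2
    omega

/-- If `⌊m/n⌋ ≥ 2` then `|D_{m,n}^{(k,ℓ)}|` only depends on `k + ℓ`:
the matrix of these cardinalities is a Hankel matrix. -/
theorem card_run_ret_hankel (m n : ℕ) (hm : 0 < m) (hn : 0 < n) (h : 2 ≤ m / n)
    (k l k' l' : ℕ) (hk : 0 < k) (hl : 0 < l) (hk' : 0 < k') (hl' : 0 < l')
    (hsum : k + l = k' + l') :
    (dyckPathsRR m n k l).card = (dyckPathsRR m n k' l').card := by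
  have hmn : 2 * n ≤ m := (Nat.le_div_iff_mul_le hn).1 h
  obtain ⟨k, rfl⟩ := Nat.exists_eq_add_of_lt hk
  obtain ⟨k', rfl⟩ := Nat.exists_eq_add_of_lt hk'
  simp only [zero_add] at hsum ⊢
  rw [card_dyckPathsRR_eq hm hn hmn k hl, card_dyckPathsRR_eq hm hn hmn k' hl',
    show k + l = k' + l' by omega]

end RationalDyck
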